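/- For every complex ζ and every τ in the complex upper half-plane, θ[1,3/5](τ)²·θ[1/5,1/5](ζ,τ)·θ[1/5,9/5](ζ,τ) − θ[1,1/5](τ)²·θ[1/5,3/5](ζ,τ)·θ[1/5,7/5](ζ,τ) + θ[1,1/5](τ)·θ[1,3/5](τ)·θ[1/5,1](ζ,τ)² = 0. -/

import Mathlib

open Complex

/-- The theta function with characteristic `[ε; ε']`:
`θ[ε,ε'](ζ,τ) = ∑_{n ∈ ℤ} exp(2πi((1/2)(n+ε/2)²τ + (n+ε/2)(ζ+ε'/2)))`. -/
noncomputable def θf (ε ε' : ℝ) (ζ τ : ℂ) : ℂ :=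
  ∑' n : ℤ, Complex.exp (2 * Real.pi * Complex.I *
    ((1 / 2) * ((n : ℂ) + (ε : ℂ) / 2) ^ 2 * τ + ((n : ℂ) + (ε : ℂ) / 2) * (ζ + (ε' : ℂ) / 2)))

/-- The theta constant: the value of the theta function at `ζ = 0`. -/
noncomputable def θ (ε ε' : ℝ) (τ : ℂ) : ℂ := θf ε ε' 0 τ

/-- `ζ₅ = exp(2πi/5)`. -/
noncomputable def ζ₅ : ℂ := Complex.exp (2 * Real.pi * Complex.I / 5)

/-- The terms of `θf 1 1` are constant multiples of the terms of `jacobiTheta₂`. -/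
lemma summable_norm_θf_one_one_term (z : ℂ) {τ : ℂ} (hτ : 0 < τ.im) :
    Summable fun n : ℤ ↦ ‖cexp (2 * Real.pi * I *
      ((1 / 2) * ((n : ℂ) + 1 / 2) ^ 2 * τ + ((n : ℂ) + 1 / 2) * (z + 1 / 2)))‖ := by
  have h := (((summable_jacobiTheta₂_term_iff (z + 1 / 2 + τ / 2) τ).2 hτ).mul_left
    (cexp (2 * Real.pi * I * (τ / 8 + (z + 1 / 2) / 2)))).norm
  refine h.congr fun n ↦ ?_
  rw [jacobiTheta₂_term, ← Complex.exp_add]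
  congr 2
  ring

lemma θf_one_one_eq (z τ : ℂ) : θf 1 1 z τ = ∑' n : ℤ, cexp (2 * Real.pi * I *
    ((1 / 2) * ((n : ℂ) + 1 / 2) ^ 2 * τ + ((n : ℂ) + 1 / 2) * (z + 1 / 2))) := by
  simp [θf]

lemma θf_one_one_neg (z τ : ℂ) : θf 1 1 (-z) τ = -θf 1 1 z τ := by
  simp only [θf_one_one_eq, ← tsum_neg]
  rw [← (Equiv.subLeft (-1 : ℤ)).tsum_eq]
  refine tsum_congr fun n ↦ ?_
  rw [Equiv.subLeft_apply, neg_eq_neg_one_mul (cexp _), ← Complex.exp_pi_mul_I, ← Complex.exp_add,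
    Complex.exp_eq_exp_iff_exists_int]
  refine ⟨-(n + 1), ?_⟩
  push_cast
  ring

lemma θf_one_one_add_one (z τ : ℂ) : θf 1 1 (z + 1) τ = -θf 1 1 z τ := by
  simp only [θf_one_one_eq, ← tsum_neg]
  refine tsum_congr fun n ↦ ?_
  rw [neg_eq_neg_one_mul (cexp _), ← Complex.exp_pi_mul_I, ← Complex.exp_add,
    Complex.exp_eq_exp_iff_exists_int]
  refine ⟨n, ?_⟩
  ring

lemma θf_one_right (ε' : ℝ) (z τ : ℂ) :
    θf 1 ε' z τ = θf 1 1 (z + ((ε' : ℂ) - 1) / 2) τ := by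
  rw [θf_one_one_eq, θf]
  refine tsum_congr fun n ↦ ?_
  congr 1
  push_cast
  ring

lemma θf_eq_exp_mul_θf_one_one (ε ε' : ℝ) (z τ : ℂ) :
    θf ε ε' z τ = cexp (2 * Real.pi * I *
      (((ε : ℂ) - 1) ^ 2 / 8 * τ + ((ε : ℂ) - 1) / 2 * (z + (ε' : ℂ) / 2))) *
      θf 1 1 (z + ((ε : ℂ) - 1) / 2 * τ + ((ε' : ℂ) - 1) / 2) τ := by
  rw [θf_one_one_eq, θf, ← tsum_mul_left]
  refine tsum_congr fun n ↦ ?_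
  rw [← Complex.exp_add]
  congr 1
  ring

/-- Pairs of integers `(m, n)`, split by the parity of `m + n`. -/
noncomputable def intProdParityEquiv : (ℤ × ℤ) ⊕ (ℤ × ℤ) ≃ ℤ × ℤ :=
  Equiv.ofBijective
    (Sum.elim (fun k ↦ (k.1 + k.2, k.1 - k.2 - 1)) (fun k ↦ (k.1 + k.2, k.1 - k.2))) <| by
    constructor
    · rintro (⟨a, b⟩ | ⟨a, b⟩) (⟨c, d⟩ | ⟨c, d⟩) h <;>
        simp only [Sum.elim_inl, Sum.elim_inr, Prod.mk.injEq, Sum.inl.injEq, Sum.inr.injEq,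
          reduceCtorEq] at h ⊢ <;> omega
    · rintro ⟨m, n⟩
      rcases Int.even_or_odd' (m + n) with ⟨k, hk | hk⟩
      · exact ⟨Sum.inr (k, m - k), by simp; omega⟩
      · exact ⟨Sum.inl (k + 1, m - k - 1), by simp; omega⟩

lemma intProdParityEquiv_inl (k l : ℤ) :
    intProdParityEquiv (Sum.inl (k, l)) = (k + l, k - l - 1) := rfl

lemma intProdParityEquiv_inr (k l : ℤ) :
    intProdParityEquiv (Sum.inr (k, l)) = (k + l, k - l) := rfl

lemma summable_norm_jacobiTheta₂_term_comp {f : ℤ → ℤ} (hf : f.Injective) (z : ℂ) {τ : ℂ}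
    (hτ : 0 < τ.im) : Summable fun k ↦ ‖jacobiTheta₂_term (f k) z τ‖ :=
  ((summable_jacobiTheta₂_term_iff z τ).2 hτ).norm.comp_injective hf

/-- The addition formula for the odd theta function. -/
lemma θf_one_one_add_mul_sub (x y : ℂ) {τ : ℂ} (hτ : 0 < τ.im) :
    θf 1 1 (x + y) τ * θf 1 1 (x - y) τ =
      (∑' k : ℤ, jacobiTheta₂_term (2 * k) x (τ / 2)) *
        (∑' k : ℤ, jacobiTheta₂_term (2 * k + 1) y (τ / 2)) -
      (∑' k : ℤ, jacobiTheta₂_term (2 * k + 1) x (τ / 2)) *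
        (∑' k : ℤ, jacobiTheta₂_term (2 * k) y (τ / 2)) := by
  have hτ' : 0 < (τ / 2).im := by simpa using hτ
  have hE (z : ℂ) := summable_norm_jacobiTheta₂_term_comp (f := fun k ↦ 2 * k)
    (fun a b h ↦ by simpa using h) z hτ'
  have hO (z : ℂ) := summable_norm_jacobiTheta₂_term_comp (f := fun k ↦ 2 * k + 1)
    (fun a b h ↦ by simpa using h) z hτ'
  have hS (z : ℂ) := summable_norm_θf_one_one_term z hτ
  have hsum := summable_mul_of_summable_norm (hS (x + y)) (hS (x - y))
  rw [θf_one_one_eq, θf_one_one_eq, tsum_mul_tsum_of_summable_norm (hS _) (hS _),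
    tsum_mul_tsum_of_summable_norm (hE _) (hO _), tsum_mul_tsum_of_summable_norm (hO _) (hE _),
    ← intProdParityEquiv.tsum_eq, sub_eq_add_neg (tsum _ _), ← tsum_neg]
  have hsum' := intProdParityEquiv.summable_iff.2 hsum
  refine (Summable.tsum_sum (hsum'.comp_injective Sum.inl_injective)
    (hsum'.comp_injective Sum.inr_injective)).trans ?_
  congr 1 <;> refine tsum_congr fun ⟨k, l⟩ ↦ ?_
  · simp only [Function.comp_apply, intProdParityEquiv_inl, jacobiTheta₂_term,
      ← Complex.exp_add]
    rw [Complex.exp_eq_exp_iff_exists_int]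
    refine ⟨k, ?_⟩
    push_cast
    ring
  · simp only [Function.comp_apply, intProdParityEquiv_inr, jacobiTheta₂_term,
      ← Complex.exp_add]
    rw [neg_eq_neg_one_mul, ← Complex.exp_pi_mul_I, ← Complex.exp_add,
      Complex.exp_eq_exp_iff_exists_int]
    refine ⟨k, ?_⟩
    push_cast
    ring

/-- Weierstrass's three-term identity for the odd theta function. -/
lemma θf_one_one_three_term (x a b c : ℂ) {τ : ℂ} (hτ : 0 < τ.im) :
    θf 1 1 (x + a) τ * θf 1 1 (x - a) τ * (θf 1 1 (b + c) τ * θf 1 1 (b - c) τ) +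
      θf 1 1 (x + b) τ * θf 1 1 (x - b) τ * (θf 1 1 (c + a) τ * θf 1 1 (c - a) τ) +
      θf 1 1 (x + c) τ * θf 1 1 (x - c) τ * (θf 1 1 (a + b) τ * θf 1 1 (a - b) τ) = 0 := by
  simp only [θf_one_one_add_mul_sub _ _ hτ]
  ring

theorem two_theta_sum_two (ζ : ℂ) (τ : ℂ) (hτ : 0 < τ.im) :
    θ 1 (3/5) τ ^ 2 * θf (1/5) (1/5) ζ τ * θf (1/5) (9/5) ζ τ - θ 1 (1/5) τ ^ 2 * θf (1/5) (3/5) ζ τ * θf (1/5) (7/5) ζ τ + θ 1 (1/5) τ * θ 1 (3/5) τ * θf (1/5) 1 ζ τ ^ 2 = 0 := by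
  have h₁ : θ 1 (3/5) τ = -θf 1 1 (1/5) τ := by
    rw [θ, θf_one_right, ← θf_one_one_neg]
    congr 1
    push_cast
    ring
  have h₂ : θ 1 (1/5) τ = -θf 1 1 (2/5) τ := by
    rw [θ, θf_one_right, ← θf_one_one_neg]
    congr 1
    push_cast
    ring
  have h₃ : θf 1 1 (3/5) τ = θf 1 1 (2/5) τ := by
    rw [show (3/5 : ℂ) = -(2/5) + 1 by ring, θf_one_one_add_one, θf_one_one_neg, neg_neg]
  set w : ℂ := ζ - 2/5 * τ with hw
  set C : ℝ → ℂ := fun ε' ↦ cexp (2 * Real.pi * I * (2/25 * τ - 2/5 * (ζ + (ε' : ℂ) / 2))) with hC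
  have hθ (ε' : ℝ) : θf (1/5) ε' ζ τ = C ε' * θf 1 1 (w + ((ε' : ℂ) - 1) / 2) τ := by
    rw [θf_eq_exp_mul_θf_one_one, hC, hw]
    congr 2 <;> push_cast <;> ring
  have hCC (s : ℝ) : C s * C (2 - s) = C 1 ^ 2 := by
    simp only [hC, sq, ← Complex.exp_add]
    congr 1
    push_cast
    ring
  have hC₁ : C (1/5) * C (9/5) = C 1 ^ 2 := by rw [← hCC (1/5)]; norm_num
  have hC₂ : C (3/5) * C (7/5) = C 1 ^ 2 := by rw [← hCC (3/5)]; norm_num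
  have key := θf_one_one_three_term w (2/5) (1/5) 0 hτ
  rw [show (2/5 + 1/5 : ℂ) = 3/5 by ring, show (2/5 - 1/5 : ℂ) = 1/5 by ring, h₃] at key
  simp only [add_zero, sub_zero, zero_add, zero_sub, θf_one_one_neg] at key
  rw [h₁, h₂, hθ, hθ, hθ, hθ, hθ]
  rw [show w + (((1/5 : ℝ) : ℂ) - 1) / 2 = w - 2/5 by push_cast; ring,
    show w + (((9/5 : ℝ) : ℂ) - 1) / 2 = w + 2/5 by push_cast; ring,
    show w + (((3/5 : ℝ) : ℂ) - 1) / 2 = w - 1/5 by push_cast; ring,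
    show w + (((7/5 : ℝ) : ℂ) - 1) / 2 = w + 1/5 by push_cast; ring,
    show w + (((1 : ℝ) : ℂ) - 1) / 2 = w by push_cast; ring]
  linear_combination C 1 ^ 2 * key +
    θf 1 1 (1/5) τ ^ 2 * θf 1 1 (w - 2/5) τ * θf 1 1 (w + 2/5) τ * hC₁ -
    θf 1 1 (2/5) τ ^ 2 * θf 1 1 (w - 1/5) τ * θf 1 1 (w + 1/5) τ * hC₂
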